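/- For every Δ* ∈ [0, Δ] and every realization of nonnegative communication delays, the following strategy profile is a Nash equilibrium of the slot-based proposal game: each proposer n releases at t_n = n·Δ + Δ* and sets φ_n = 1 iff t_{n−1} ≤ (n−1)·Δ + Δ*; each attester (i,n) sets ν_{(i,n)} = 1 and τ_{(i,n)} = t_n + δ_{n,(i,n)} if proposer n released at t_n = n·Δ + Δ* and followed the φ rule, and otherwise sets ν_{(i,n)} = 0 and τ_{(i,n)} = n·Δ. Nash equilibrium means: no proposer n can strictly increase their payoff U^P_n by unilaterally changing (t_n, φ_n) within the feasible set {(t,φ) : t ≥ n·Δ, φ ∈ {0,1}}, and no single attester (i,n) can strictly increase their payoff U^A_{(i,n)} by unilaterally changing (ν_{(i,n)}, τ_{(i,n)}) within its feasible set (τ ≥ n·Δ, and ν = 1 → τ ≥ t_n + δ_{n,(i,n)}). (Note: changing the action of a single attester i, a measure-zero set, does not change the measure Ã_n.) -/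

import Mathlib

/-!
Slot-based proposal game (timing games in Proof-of-Stake), Proposition 1
(multiple equilibria): for every Δ* ∈ [0, Δ] and every realization of
nonnegative communication delays, the prescribed strategy profile is a Nash
equilibrium: no proposer and no single attester can strictly increase their
payoff by a unilateral feasible deviation.
-/

open MeasureTheory
open scoped Classical

noncomputable section

/-- Successful-attestation measure: Lebesgue measure of the set of attesters
`i ∈ [0,1]` voting for the block. -/
def attMeasure (ν : ℝ → Prop) : ℝ :=
  (volume {i : ℝ | i ∈ Set.Icc (0 : ℝ) 1 ∧ ν i}).toReal

/-- Canonicity indicator of slot `n`: the next proposer builds on block `n`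
and block `n` gathers at least measure `γ` of attestations. -/
def chi (γ : ℝ) (φ : ℕ → Prop) (ν : ℕ → ℝ → Prop) (n : ℕ) : Prop :=
  φ (n + 1) ∧ γ ≤ attMeasure (ν n)

/-- The most recent canonical slot `n_- = max {k ≤ n - 1 : χ_k = 1}`. -/
def lastCanonical (γ : ℝ) (φ : ℕ → Prop) (ν : ℕ → ℝ → Prop) (n : ℕ) : ℕ :=
  sSup {k : ℕ | chi γ φ ν k ∧ k ≤ n - 1}

/-- Proposer `n`'s payoff: `α + μ·(t_n − t_{n_-})⁺` if block `n` is canonical,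
`0` otherwise. -/
def proposerPayoff (α μ γ : ℝ) (t : ℕ → ℝ) (φ : ℕ → Prop) (ν : ℕ → ℝ → Prop)
    (n : ℕ) : ℝ :=
  if chi γ φ ν n then α + μ * max (t n - t (lastCanonical γ φ ν n)) 0 else 0

/-- Attester `(i, n)`'s payoff given their release time `τ` and realized delay
`δout` to proposer `n + 1`: `1` iff the vote is correct (`ν_{(i,n)} = χ_n`),
fresh (`τ + δout ≤ t_{n+1}`) and `χ_{n+1} = 1`, else `0`. -/
def attesterPayoff (γ : ℝ) (t : ℕ → ℝ) (φ : ℕ → Prop) (ν : ℕ → ℝ → Prop)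
    (n : ℕ) (i : ℝ) (τ δout : ℝ) : ℝ :=
  if (ν n i ↔ chi γ φ ν n) ∧ τ + δout ≤ t (n + 1) ∧ chi γ φ ν (n + 1) then 1 else 0

/-- Proposer `n` acted "on path": released at `n·Δ + Δ*` and followed the
φ-rule (build on block `n-1` iff `t_{n-1} ≤ (n-1)·Δ + Δ*`). -/
def onPath (Δ Δstar : ℝ) (t : ℕ → ℝ) (φ : ℕ → Prop) (n : ℕ) : Prop :=
  t n = (n : ℝ) * Δ + Δstar ∧
    (φ n ↔ t (n - 1) ≤ ((n - 1 : ℕ) : ℝ) * Δ + Δstar)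

/-- Equilibrium release times: `t_n = n·Δ + Δ*`. -/
def tEq (Δ Δstar : ℝ) (n : ℕ) : ℝ := (n : ℝ) * Δ + Δstar

/-- Equilibrium build decisions: `φ_n = 1` iff `t_{n-1} ≤ (n-1)·Δ + Δ*`. -/
def phiEq (Δ Δstar : ℝ) (n : ℕ) : Prop :=
  tEq Δ Δstar (n - 1) ≤ ((n - 1 : ℕ) : ℝ) * Δ + Δstar

/-- Equilibrium votes, as a reaction to the realized proposer actions:
attester `(i, n)` votes `1` iff proposer `n` acted on path. -/
def nuEq (Δ Δstar : ℝ) (t : ℕ → ℝ) (φ : ℕ → Prop) (n : ℕ) (_ : ℝ) : Prop :=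
  onPath Δ Δstar t φ n

/-- Equilibrium attestation release times: `t_n + δ_{n,(i,n)}` if proposer `n`
acted on path, `n·Δ` otherwise. -/
def tauEq (Δ Δstar : ℝ) (δin : ℕ → ℝ → ℝ) (t : ℕ → ℝ) (φ : ℕ → Prop)
    (n : ℕ) (i : ℝ) : ℝ :=
  if onPath Δ Δstar t φ n then t n + δin n i else (n : ℝ) * Δ

/-- Realized release times when proposer `n₀` unilaterally deviates to
releasing at time `T` (all other proposers follow the equilibrium). -/
def tDev (Δ Δstar : ℝ) (n₀ : ℕ) (T : ℝ) (n : ℕ) : ℝ :=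
  if n = n₀ then T else tEq Δ Δstar n

/-- Realized build decisions when proposer `n₀` unilaterally deviates to
`(T, Φ)`: every other proposer `m` follows the equilibrium φ-rule applied to
the realized release times. -/
def phiDev (Δ Δstar : ℝ) (n₀ : ℕ) (T : ℝ) (Φ : Prop) (n : ℕ) : Prop :=
  if n = n₀ then Φ
  else tDev Δ Δstar n₀ T (n - 1) ≤ ((n - 1 : ℕ) : ℝ) * Δ + Δstar

theorem attMeasure_congr_off_point {ν ν' : ℝ → Prop} (i₀ : ℝ)
    (h : ∀ i, i ≠ i₀ → (ν i ↔ ν' i)) : attMeasure ν = attMeasure ν' := by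
  unfold attMeasure
  congr 1
  refine measure_congr ?_
  filter_upwards [Measure.ae_ne volume i₀] with i hi
  exact propext (and_congr_right fun _ => h i hi)

theorem attMeasure_of_forall {ν : ℝ → Prop} (h : ∀ i, ν i) : attMeasure ν = 1 := by
  simp [attMeasure, h, -Set.mem_Icc]

theorem attMeasure_of_forall_not {ν : ℝ → Prop} (h : ∀ i, ¬ ν i) : attMeasure ν = 0 := by
  simp [attMeasure, h]

theorem proposerPayoff_nonneg {α μ : ℝ} (hα : 0 ≤ α) (hμ : 0 ≤ μ) (γ : ℝ) (t : ℕ → ℝ)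
    (φ : ℕ → Prop) (ν : ℕ → ℝ → Prop) (n : ℕ) : 0 ≤ proposerPayoff α μ γ t φ ν n := by
  unfold proposerPayoff
  split_ifs
  · positivity
  · rfl

theorem attesterPayoff_le_of_imp {γ : ℝ} {t : ℕ → ℝ} {φ : ℕ → Prop} {ν ν' : ℕ → ℝ → Prop}
    {n : ℕ} {i τ τ' d : ℝ}
    (h : (ν n i ↔ chi γ φ ν n) ∧ τ + d ≤ t (n + 1) ∧ chi γ φ ν (n + 1) →
      (ν' n i ↔ chi γ φ ν' n) ∧ τ' + d ≤ t (n + 1) ∧ chi γ φ ν' (n + 1)) :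
    attesterPayoff γ t φ ν n i τ d ≤ attesterPayoff γ t φ ν' n i τ' d := by
  unfold attesterPayoff
  split_ifs with hp hq
  · rfl
  · exact absurd (h hp) hq
  · exact zero_le_one
  · rfl

theorem phiEq_holds (Δ Δstar : ℝ) (n : ℕ) : phiEq Δ Δstar n := le_refl _

theorem onPath_eq (Δ Δstar : ℝ) (n : ℕ) :
    onPath Δ Δstar (tEq Δ Δstar) (phiEq Δ Δstar) n :=
  ⟨rfl, Iff.rfl⟩

theorem not_chi_of_not_onPath {Δ Δstar γ : ℝ} (hγ : 0 < γ) {t : ℕ → ℝ} {φ : ℕ → Prop} {n : ℕ}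
    (h : ¬ onPath Δ Δstar t φ n) : ¬ chi γ φ (nuEq Δ Δstar t φ) n := fun hc => by
  have h0 := hc.2
  rw [attMeasure_of_forall_not (ν := nuEq Δ Δstar t φ n) fun _ => h] at h0
  exact hγ.not_ge h0

theorem chi_eq {Δ Δstar γ : ℝ} (hγ : γ ≤ 1) (n : ℕ) :
    chi γ (phiEq Δ Δstar) (nuEq Δ Δstar (tEq Δ Δstar) (phiEq Δ Δstar)) n :=
  ⟨phiEq_holds Δ Δstar (n + 1), hγ.trans_eq
    (attMeasure_of_forall (ν := nuEq Δ Δstar _ _ n) fun _ => onPath_eq Δ Δstar n).symm⟩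

theorem tDev_eq_of_onPath {Δ Δstar T : ℝ} {Φ : Prop} {n₀ : ℕ}
    (h : onPath Δ Δstar (tDev Δ Δstar n₀ T) (phiDev Δ Δstar n₀ T Φ) n₀) :
    tDev Δ Δstar n₀ T = tEq Δ Δstar := by
  funext n
  by_cases hn : n = n₀
  · subst hn
    exact h.1
  · simp [tDev, hn]

theorem phiDev_eq_of_onPath {Δ Δstar T : ℝ} {Φ : Prop} {n₀ : ℕ}
    (h : onPath Δ Δstar (tDev Δ Δstar n₀ T) (phiDev Δ Δstar n₀ T Φ) n₀) :
    phiDev Δ Δstar n₀ T Φ = phiEq Δ Δstar := by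
  have ht := tDev_eq_of_onPath h
  funext n
  by_cases hn : n = n₀
  · subst hn
    have h2 := h.2
    rw [ht] at h2
    exact propext h2
  · simp [phiDev, phiEq, hn, ht]

/-- **Proposition 1 (Multiple equilibria).** For any `Δ* ∈ [0, Δ]` and any
realization of nonnegative delays, the prescribed strategy profile is a Nash
equilibrium: (1) no proposer `n₀` can strictly increase their payoff by a
unilateral feasible deviation `(T, Φ)` with `T ≥ n₀·Δ` (attesters and
subsequent proposers reacting as prescribed); (2) no single attester
`(i₀, n₀)` can strictly increase their payoff by a unilateral feasible
deviation `(v, τ)` with `τ ≥ n₀·Δ` and `v → τ ≥ t_{n₀} + δ_{n₀,(i₀,n₀)}`. -/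
theorem timing_games_nash_equilibrium
    (Δ Δstar γ α μ : ℝ)
    (hΔ : 0 < Δ) (hstar : Δstar ∈ Set.Icc (0 : ℝ) Δ)
    (hγ : γ ∈ Set.Ioc (0 : ℝ) 1) (hα : 0 < α) (hμ : 0 < μ)
    (δin δout : ℕ → ℝ → ℝ)
    (hδin : ∀ n i, 0 ≤ δin n i) (hδout : ∀ n i, 0 ≤ δout n i) :
    -- (1) no proposer can profitably deviate
    (∀ (n₀ : ℕ) (T : ℝ) (Φ : Prop), (n₀ : ℝ) * Δ ≤ T →
      proposerPayoff α μ γ (tDev Δ Δstar n₀ T) (phiDev Δ Δstar n₀ T Φ)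
          (nuEq Δ Δstar (tDev Δ Δstar n₀ T) (phiDev Δ Δstar n₀ T Φ)) n₀ ≤
        proposerPayoff α μ γ (tEq Δ Δstar) (phiEq Δ Δstar)
          (nuEq Δ Δstar (tEq Δ Δstar) (phiEq Δ Δstar)) n₀) ∧
    -- (2) no single attester can profitably deviate
    (∀ (n₀ : ℕ) (i₀ : ℝ), i₀ ∈ Set.Icc (0 : ℝ) 1 →
      ∀ (v : Prop) (τ : ℝ), (n₀ : ℝ) * Δ ≤ τ →
        (v → tEq Δ Δstar n₀ + δin n₀ i₀ ≤ τ) →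
        attesterPayoff γ (tEq Δ Δstar) (phiEq Δ Δstar)
            (fun m j => if m = n₀ ∧ j = i₀ then v
              else nuEq Δ Δstar (tEq Δ Δstar) (phiEq Δ Δstar) m j)
            n₀ i₀ τ (δout n₀ i₀) ≤
          attesterPayoff γ (tEq Δ Δstar) (phiEq Δ Δstar)
            (nuEq Δ Δstar (tEq Δ Δstar) (phiEq Δ Δstar))
            n₀ i₀ (tauEq Δ Δstar δin (tEq Δ Δstar) (phiEq Δ Δstar) n₀ i₀)
            (δout n₀ i₀)) := by
  refine ⟨fun n₀ T Φ _ => ?_, fun n₀ i₀ _ v τ _ hv => ?_⟩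
  · by_cases h : onPath Δ Δstar (tDev Δ Δstar n₀ T) (phiDev Δ Δstar n₀ T Φ) n₀
    · rw [phiDev_eq_of_onPath h, tDev_eq_of_onPath h]
    · rw [proposerPayoff, if_neg (not_chi_of_not_onPath hγ.1 h)]
      exact proposerPayoff_nonneg hα.le hμ.le ..
  · have hchi := chi_eq (Δ := Δ) (Δstar := Δstar) hγ.2
    refine attesterPayoff_le_of_imp fun ⟨hvote, hfresh, _⟩ =>
      ⟨iff_of_true (onPath_eq Δ Δstar n₀) (hchi n₀), ?_, hchi (n₀ + 1)⟩
    have hvotes : v := by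
      have := hvote.2 ⟨(hchi n₀).1, (hchi n₀).2.trans_eq
        (attMeasure_congr_off_point i₀ fun i hi => by simp [hi])⟩
      simpa using this
    rw [tauEq, if_pos (onPath_eq Δ Δstar n₀)]
    linarith [hv hvotes]
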